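/- arXiv:2604.02644 — 2 statements merged into one kernel-verified Lean document; each statement's English description precedes it below -/
import Mathlib

section
/- Lower bound of Proposition 1: For any measurable encoder Φ_Y : Y → Z with Z = Φ_Y(Y), and any measurable map Ḡ_X : Z × U → X, the latent conditional OT cost R_Z(Ḡ_X; Φ_Y) = ∫_Z W_{c_X}(P_{X|Z=z}, Ḡ_X(z,·) # P_U) P_Z(dz) is bounded above by the conditional OT cost R_Y(Ḡ_X; Φ_Y) = ∫_Y W_{c_X}(P_{X|Y=y}, Ḡ_X(Φ_Y(y),·) # P_U) P_Y(dy). -/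
open MeasureTheory ProbabilityTheory
open scoped ENNReal

/-- The optimal transport cost `W_c(μ, ν)`: the infimum, over couplings `π` of `μ` and `ν`,
of `∫ c dπ`. -/
noncomputable def otCost {α β : Type*} [MeasurableSpace α] [MeasurableSpace β]
    (c : α → β → ℝ≥0∞) (μ : Measure α) (ν : Measure β) : ℝ≥0∞ :=
  ⨅ π ∈ {π : Measure (α × β) | π.map Prod.fst = μ ∧ π.map Prod.snd = ν},
    ∫⁻ p, c p.1 p.2 ∂π

open Set Filter Topology
open scoped NNReal

lemma aux_lsc_lintegral {M : Type*} [TopologicalSpace M] [CompactSpace M] [T2Space M]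
    [SecondCountableTopology M] [MeasurableSpace M] [BorelSpace M]
    (f : M → ℝ≥0∞) (hf : LowerSemicontinuous f) :
    LowerSemicontinuous fun π : ProbabilityMeasure M => ∫⁻ x, f x ∂(π : Measure M) := by
  let 𝓕 : Set (M → ℝ≥0∞) := {h | ∃ g : C(M, ℝ≥0), (h = fun x => (g x : ℝ≥0∞)) ∧ h ≤ f}
  have hLUB : IsLUB 𝓕 f := by
    refine ⟨fun h ⟨g, _, hg⟩ => hg, fun u hu x => ?_⟩
    refine le_of_forall_lt fun a ha => ?_
    obtain ⟨b, hab, hb⟩ := ENNReal.lt_iff_exists_nnreal_btwn.1 ha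
    have hcl : IsClosed (f ⁻¹' Iic (b : ℝ≥0∞)) := hf.isClosed_preimage _
    obtain ⟨φ, h0, h1, h01⟩ := exists_continuous_zero_one_of_isClosed hcl
      (isClosed_singleton (x := x)) (by simpa using hb)
    let g : C(M, ℝ≥0) := ⟨fun y => b * Real.toNNReal (φ y), by fun_prop⟩
    have hg : (fun y => (g y : ℝ≥0∞)) ∈ 𝓕 := by
      refine ⟨g, rfl, fun y => ?_⟩
      by_cases hy : f y ≤ b
      · have : φ y = 0 := h0 hy
        simp [g, this]
      · refine le_trans ?_ (not_le.1 hy).le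
        have : Real.toNNReal (φ y) ≤ 1 := by simpa using (h01 y).2
        have : b * Real.toNNReal (φ y) ≤ b := mul_le_of_le_one_right (zero_le) this
        exact ENNReal.coe_le_coe.2 this
    have := hu hg x
    have h1x : φ x = 1 := h1 rfl
    simp only [g, ContinuousMap.coe_mk, h1x, Real.toNNReal_one, mul_one] at this
    exact hab.trans_le this
  obtain ⟨𝓕', hsub, hcount, hLUB'⟩ := exists_countable_lowerSemicontinuous_isLUB
    (s := f) (𝓕 := 𝓕) (by
      rintro h ⟨g, rfl, -⟩
      exact (ENNReal.continuous_coe.comp g.continuous).lowerSemicontinuous) hLUB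
  have h0F : (fun _ => 0 : M → ℝ≥0∞) ∈ 𝓕 := ⟨0, by ext; simp, fun _ => zero_le⟩
  obtain ⟨G, hG⟩ := (hcount.insert (fun _ => 0 : M → ℝ≥0∞)).exists_eq_range (insert_nonempty _ _)
  have hG𝓕 : ∀ n, G n ∈ 𝓕 := fun n => by
    have : G n ∈ insert (fun _ => 0 : M → ℝ≥0∞) 𝓕' := hG ▸ mem_range_self n
    rcases this with h | h
    · rw [h]; exact h0F
    · exact hsub h
  choose g hg hgf using hG𝓕
  have hsup : ∀ x, f x = ⨆ n, (partialSups g n x : ℝ≥0∞) := by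
    intro x
    apply le_antisymm
    · have h1 : f ≤ fun x => ⨆ n, (partialSups g n x : ℝ≥0∞) := by
        apply hLUB'.2
        intro h hh
        obtain ⟨n, rfl⟩ : h ∈ range G := hG ▸ mem_insert_of_mem _ hh
        intro x
        refine le_trans ?_ (le_iSup _ n)
        rw [hg n]
        have := (le_partialSups g n) x
        exact ENNReal.coe_le_coe.2 this
      exact h1 x
    · refine iSup_le fun n => ?_
      induction n with
      | zero => have := hgf 0 x; rw [hg 0] at this; simpa using this
      | succ n ih =>
        have := hgf (n+1) x; rw [hg (n+1)] at this
        rw [partialSups_add_one]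
        simp only [ContinuousMap.sup_apply, ENNReal.coe_max]
        exact sup_le ih this
  have : (fun π : ProbabilityMeasure M => ∫⁻ x, f x ∂(π : Measure M))
      = fun π : ProbabilityMeasure M => ⨆ n, ∫⁻ x, (partialSups g n x : ℝ≥0∞) ∂(π : Measure M) := by
    ext π
    simp_rw [hsup]
    apply lintegral_iSup
    · intro n
      exact (ENNReal.continuous_coe.comp (partialSups g n).continuous).measurable
    · intro n m hnm x
      have := (partialSups g).monotone hnm x
      exact ENNReal.coe_le_coe.2 this
  rw [this]
  exact lowerSemicontinuous_iSup fun n =>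
    (ProbabilityMeasure.continuous_lintegral_continuousMap (partialSups g n)).lowerSemicontinuous

set_option linter.unusedSectionVars false

section Compact

variable {K : Type*} [TopologicalSpace K] [CompactSpace K] [T2Space K]
    [SecondCountableTopology K] [MeasurableSpace K] [BorelSpace K]

lemma aux_ext {μ ν : Measure K} [IsFiniteMeasure μ] [IsFiniteMeasure ν]
    (h : ∀ f : C(K, ℝ), ∫ x, f x ∂μ = ∫ x, f x ∂ν) : μ = ν :=
  ext_of_forall_integral_eq_of_IsFiniteMeasure fun f => h f.toContinuousMap

lemma aux_integrable (f : C(K, ℝ)) (μ : Measure K) [IsFiniteMeasure μ] : Integrable f μ :=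
  (BoundedContinuousFunction.mkOfCompact f).integrable μ

lemma aux_map_eq_iff {π : Measure (K × K)} [IsProbabilityMeasure π] {μ : Measure K}
    [IsProbabilityMeasure μ] {g : K × K → K} (hg : Continuous g) :
    π.map g = μ ↔ ∀ f : C(K, ℝ), ∫ p, f (g p) ∂π = ∫ x, f x ∂μ := by
  have : IsProbabilityMeasure (π.map g) := Measure.isProbabilityMeasure_map hg.measurable.aemeasurable
  have key : ∀ f : C(K, ℝ), ∫ p, f (g p) ∂π = ∫ x, f x ∂(π.map g) := fun f =>
    (integral_map hg.measurable.aemeasurable f.continuous.aestronglyMeasurable).symm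
  constructor
  · rintro rfl f; exact key f
  · intro h; exact aux_ext fun f => by rw [← key, h]

lemma aux_cont (f : C(K, ℝ)) {g : K × K → K} (hg : Continuous g) :
    Continuous fun π : ProbabilityMeasure (K × K) => ∫ p, f (g p) ∂(π : Measure (K × K)) :=
  ProbabilityMeasure.continuous_integral_continuousMap (f.comp ⟨g, hg⟩)

lemma aux_attain (c : K → K → ℝ≥0∞) (hc : LowerSemicontinuous fun p : K × K => c p.1 p.2)
    (μ ν : Measure K) [IsProbabilityMeasure μ] [IsProbabilityMeasure ν] :
    ∃ π : ProbabilityMeasure (K × K), (π : Measure (K × K)).map Prod.fst = μ ∧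
      (π : Measure (K × K)).map Prod.snd = ν ∧
      ∫⁻ p, c p.1 p.2 ∂(π : Measure (K × K)) = otCost c μ ν := by
  let S : Set (ProbabilityMeasure (K × K)) := {π | (π : Measure (K × K)).map Prod.fst = μ ∧
      (π : Measure (K × K)).map Prod.snd = ν}
  have hS : IsClosed S := by
    have : S = (⋂ f : C(K, ℝ), {π : ProbabilityMeasure (K × K) |
          ∫ p, f p.1 ∂(π : Measure (K × K)) = ∫ x, f x ∂μ}) ∩
        ⋂ f : C(K, ℝ), {π : ProbabilityMeasure (K × K) |
          ∫ p, f p.2 ∂(π : Measure (K × K)) = ∫ x, f x ∂ν} := by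
      ext π
      simp only [S, mem_ofPred_eq, mem_inter_iff, mem_iInter, aux_map_eq_iff continuous_fst,
        aux_map_eq_iff continuous_snd]
    rw [this]
    exact (isClosed_iInter fun f => isClosed_eq (aux_cont f continuous_fst) continuous_const).inter
      (isClosed_iInter fun f => isClosed_eq (aux_cont f continuous_snd) continuous_const)
  have hne : S.Nonempty := ⟨⟨μ.prod ν, inferInstance⟩, by
    change (μ.prod ν).map Prod.fst = μ ∧ (μ.prod ν).map Prod.snd = ν
    simp⟩
  obtain ⟨π, hπ, hmin⟩ := ((aux_lsc_lintegral _ hc).lowerSemicontinuousOn S).exists_isMinOn hne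
    hS.isCompact
  refine ⟨π, hπ.1, hπ.2, le_antisymm ?_ ?_⟩
  · refine le_iInf₂ fun π' hπ' => ?_
    have : IsProbabilityMeasure π' := by
      constructor
      have h : π'.map Prod.fst univ = 1 := by rw [hπ'.1]; simp
      rwa [Measure.map_apply measurable_fst MeasurableSet.univ, preimage_univ] at h
    exact hmin (show (⟨π', this⟩ : ProbabilityMeasure (K × K)) ∈ S from hπ')
  · exact iInf₂_le (π : Measure (K × K)) hπ

lemma aux_le_iff (c : K → K → ℝ≥0∞) (hc : LowerSemicontinuous fun p : K × K => c p.1 p.2)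
    (μ ν : Measure K) [IsProbabilityMeasure μ] [IsProbabilityMeasure ν] (a : ℝ≥0∞) :
    otCost c μ ν ≤ a ↔ ∃ π : ProbabilityMeasure (K × K), (π : Measure (K × K)).map Prod.fst = μ ∧
      (π : Measure (K × K)).map Prod.snd = ν ∧
      ∫⁻ p, c p.1 p.2 ∂(π : Measure (K × K)) ≤ a := by
  constructor
  · intro h
    obtain ⟨π, h1, h2, h3⟩ := aux_attain c hc μ ν
    exact ⟨π, h1, h2, h3 ▸ h⟩
  · rintro ⟨π, h1, h2, h3⟩
    exact (iInf₂_le (π : Measure (K × K)) ⟨h1, h2⟩).trans h3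

/-- Measurability of the conditional transport cost. -/
lemma aux_meas (c : K → K → ℝ≥0∞) (hc : LowerSemicontinuous fun p : K × K => c p.1 p.2)
    {Y : Type*} [MeasurableSpace Y] (κ η : Kernel Y K) [IsMarkovKernel κ] [IsMarkovKernel η] :
    Measurable fun y => otCost c (κ y) (η y) := by
  refine measurable_of_Iic fun a => ?_
  let d : ℕ → C(K, ℝ) := TopologicalSpace.denseSeq C(K, ℝ)
  have hd : DenseRange d := TopologicalSpace.denseRange_denseSeq _
  have hext : ∀ (μ : Measure K) [IsProbabilityMeasure μ] (π : ProbabilityMeasure (K × K))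
      (g : K × K → K) (_ : Continuous g),
      (π : Measure (K × K)).map g = μ ↔ ∀ n, ∫ p, d n (g p) ∂(π : Measure (K × K)) = ∫ x, d n x ∂μ := by
    intro μ _ π g hg
    rw [aux_map_eq_iff hg]
    refine ⟨fun h n => h _, fun h => ?_⟩
    have hIntF : ∀ (E : Type _) [TopologicalSpace E] [CompactSpace E] [T2Space E]
      [SecondCountableTopology E] [MeasurableSpace E] [BorelSpace E] (m : Measure E)
      [IsProbabilityMeasure m], Continuous fun f : C(E, ℝ) => ∫ x, f x ∂m := by
      intro E _ _ _ _ _ _ m _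
      refine LipschitzWith.continuous (K := 1) (LipschitzWith.of_dist_le_mul fun f f' => ?_)
      rw [dist_eq_norm, ← integral_sub (aux_integrable f m) (aux_integrable f' m)]
      refine (norm_integral_le_of_norm_le_const (C := dist f f') (.of_forall fun x => ?_)).trans ?_
      · rw [← dist_eq_norm]; exact ContinuousMap.dist_apply_le_dist x
      · simp
    have h1 : Continuous fun f : C(K, ℝ) => ∫ p, f (g p) ∂(π : Measure (K × K)) :=
      (hIntF _ (π : Measure (K × K))).comp (ContinuousMap.continuous_precomp ⟨g, hg⟩)
    exact fun f => congrFun (hd.equalizer h1 (hIntF _ μ) (funext h)) f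
  let T : ProbabilityMeasure (K × K) → (ℕ → ℝ) × (ℕ → ℝ) := fun π =>
    (fun n => ∫ p, d n p.1 ∂(π : Measure (K × K)), fun n => ∫ p, d n p.2 ∂(π : Measure (K × K)))
  have hT : Continuous T := (continuous_pi fun n => aux_cont _ continuous_fst).prodMk
    (continuous_pi fun n => aux_cont _ continuous_snd)
  let S : Set (ProbabilityMeasure (K × K)) := {π | ∫⁻ p, c p.1 p.2 ∂(π : Measure (K × K)) ≤ a}
  have hS : IsClosed S := (aux_lsc_lintegral _ hc).isClosed_preimage a
  have hTS : IsClosed (T '' S) := (hS.isCompact.image hT).isClosed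
  let R : Y → (ℕ → ℝ) × (ℕ → ℝ) := fun y => (fun n => ∫ x, d n x ∂(κ y), fun n => ∫ x, d n x ∂(η y))
  have hR : Measurable R := by
    refine (measurable_pi_lambda _ fun n => ?_).prodMk (measurable_pi_lambda _ fun n => ?_)
    · exact ((d n).continuous.stronglyMeasurable.integral_kernel (κ := κ)).measurable
    · exact ((d n).continuous.stronglyMeasurable.integral_kernel (κ := η)).measurable
  convert hR hTS.measurableSet using 1
  ext y
  simp only [mem_preimage, mem_Iic, aux_le_iff c hc, mem_image, S, T, R, mem_ofPred_eq,
    Prod.mk.injEq, funext_iff, hext _ _ _ continuous_fst, hext _ _ _ continuous_snd]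
  exact ⟨fun ⟨π, h1, h2, h3⟩ => ⟨π, h3, h1, h2⟩, fun ⟨π, h3, h1, h2⟩ => ⟨π, h1, h2, h3⟩⟩

/-- Jensen's inequality for the transport cost in its first argument. -/
lemma aux_jensen (c : K → K → ℝ≥0∞) (hc : LowerSemicontinuous fun p : K × K => c p.1 p.2)
    {Y : Type*} [MeasurableSpace Y] (Q : Measure Y) [IsProbabilityMeasure Q]
    (κ : Kernel Y K) [IsMarkovKernel κ] (ν : Measure K) [IsProbabilityMeasure ν] :
    otCost c (Q.bind κ) ν ≤ ∫⁻ y, otCost c (κ y) ν ∂Q := by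
  have hW : Measurable fun y => otCost c (κ y) ν := aux_meas c hc κ (Kernel.const Y ν)
  by_cases htop : ∫⁻ y, otCost c (κ y) ν ∂Q = ⊤
  · rw [htop]; exact le_top
  have hfin : ∀ᵐ y ∂Q, otCost c (κ y) ν < ⊤ := ae_lt_top hW htop
  have hC := aux_lsc_lintegral _ hc
  set I := ∫⁻ y, otCost c (κ y) ν ∂Q with hI
  -- the compact constraint set
  let S : Set (ProbabilityMeasure (K × K)) := {π | (∀ g : C(K, ℝ),
      ∫ p, g p.2 ∂(π : Measure (K × K)) = ∫ x, g x ∂ν) ∧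
      ∫⁻ p, c p.1 p.2 ∂(π : Measure (K × K)) ≤ I}
  have hS2 : IsClosed {π : ProbabilityMeasure (K × K) | ∀ g : C(K, ℝ),
      ∫ p, g p.2 ∂(π : Measure (K × K)) = ∫ x, g x ∂ν} := by
    rw [show {π : ProbabilityMeasure (K × K) | ∀ g : C(K, ℝ),
      ∫ p, g p.2 ∂(π : Measure (K × K)) = ∫ x, g x ∂ν} = ⋂ g : C(K, ℝ),
        {π : ProbabilityMeasure (K × K) | ∫ p, g p.2 ∂(π : Measure (K × K)) = ∫ x, g x ∂ν} by
        ext; simp]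
    exact isClosed_iInter fun f => isClosed_eq (aux_cont f continuous_snd) continuous_const
  have hS : IsClosed S := hS2.inter (hC.isClosed_preimage I)
  let A : C(K, ℝ) → Set (ProbabilityMeasure (K × K)) := fun f =>
    {π | ∫ p, f p.1 ∂(π : Measure (K × K)) = ∫ y, ∫ x, f x ∂(κ y) ∂Q}
  have hA : ∀ f, IsClosed (A f) := fun f => isClosed_eq (aux_cont f continuous_fst) continuous_const
  have key : (S ∩ ⋂ f, A f).Nonempty := by
    refine hS.isCompact.inter_iInter_nonempty A hA fun s => ?_
    let E : Set ((s → ℝ) × ℝ) := {w | ∃ π : ProbabilityMeasure (K × K), (∀ g : C(K, ℝ),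
      ∫ p, g p.2 ∂(π : Measure (K × K)) = ∫ x, g x ∂ν) ∧
      (∀ f : s, ∫ p, f.1 p.1 ∂(π : Measure (K × K)) = w.1 f) ∧ 0 ≤ w.2 ∧
      ∫⁻ p, c p.1 p.2 ∂(π : Measure (K × K)) ≤ ENNReal.ofReal w.2}
    have hEc : IsClosed E := by
      let D : Set (ProbabilityMeasure (K × K) × ((s → ℝ) × ℝ)) := {q | (∀ g : C(K, ℝ),
        ∫ p, g p.2 ∂(q.1 : Measure (K × K)) = ∫ x, g x ∂ν) ∧
        (∀ f : s, ∫ p, f.1 p.1 ∂(q.1 : Measure (K × K)) = q.2.1 f) ∧ 0 ≤ q.2.2 ∧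
        ∫⁻ p, c p.1 p.2 ∂(q.1 : Measure (K × K)) ≤ ENNReal.ofReal q.2.2}
      have hD : IsClosed D := by
        refine (hS2.preimage continuous_fst).inter (IsClosed.inter ?_ (IsClosed.inter ?_ ?_))
        · have : IsClosed (⋂ f : s, {q : ProbabilityMeasure (K × K) × ((s → ℝ) × ℝ) |
              ∫ p, f.1 p.1 ∂(q.1 : Measure (K × K)) = q.2.1 f}) :=
            isClosed_iInter fun f => isClosed_eq
              ((aux_cont f.1 continuous_fst).comp continuous_fst) (by fun_prop)
          rw [show (⋂ f : s, {q : ProbabilityMeasure (K × K) × ((s → ℝ) × ℝ) |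
              ∫ p, f.1 p.1 ∂(q.1 : Measure (K × K)) = q.2.1 f}) =
            {q : ProbabilityMeasure (K × K) × ((s → ℝ) × ℝ) | ∀ f : s,
              ∫ p, f.1 p.1 ∂(q.1 : Measure (K × K)) = q.2.1 f} by ext; simp] at this
          exact this
        · exact isClosed_le (f := fun _ : ProbabilityMeasure (K × K) × ((s → ℝ) × ℝ) => (0 : ℝ))
            (g := fun q => q.2.2) continuous_const (by fun_prop)
        · exact hC.isClosed_epigraph.preimage
            (f := fun q : ProbabilityMeasure (K × K) × ((s → ℝ) × ℝ) =>
              (q.1, ENNReal.ofReal q.2.2)) (continuous_fst.prodMk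
                (ENNReal.continuous_ofReal.comp (by fun_prop)))
      convert! isClosedMap_snd_of_compactSpace D hD using 1
      ext w
      constructor
      · rintro ⟨π, h⟩; exact ⟨(π, w), h, rfl⟩
      · rintro ⟨⟨π, w'⟩, h, rfl⟩; exact ⟨π, h⟩
    have hEconv : Convex ℝ E := by
      rintro w ⟨π, h1, h2, h3, h4⟩ w' ⟨π', h1', h2', h3', h4'⟩ a b ha hb hab
      let m : Measure (K × K) := ENNReal.ofReal a • (π : Measure (K × K)) +
        ENNReal.ofReal b • (π' : Measure (K × K))
      have hm : IsProbabilityMeasure m := ⟨by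
        simp [m, ← ENNReal.ofReal_add ha hb, hab]⟩
      have hIntF : ∀ f : C(K × K, ℝ), ∫ p, f p ∂m =
          a * ∫ p, f p ∂(π : Measure (K × K)) + b * ∫ p, f p ∂(π' : Measure (K × K)) := by
        intro f
        have i1 := (aux_integrable f (π : Measure (K × K))).smul_measure (c := ENNReal.ofReal a)
          ENNReal.ofReal_ne_top
        have i2 := (aux_integrable f (π' : Measure (K × K))).smul_measure (c := ENNReal.ofReal b)
          ENNReal.ofReal_ne_top
        rw [integral_add_measure i1 i2, integral_smul_measure, integral_smul_measure]
        simp [ha, hb]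
      refine ⟨⟨m, hm⟩, fun g => ?_, fun f => ?_, ?_, ?_⟩
      · have := hIntF (g.comp ⟨Prod.snd, continuous_snd⟩)
        simp only [ContinuousMap.comp_apply, ContinuousMap.coe_mk, h1, h1'] at this
        rw [← add_mul, hab, one_mul] at this
        exact this
      · have := hIntF (f.1.comp ⟨Prod.fst, continuous_fst⟩)
        simp only [ContinuousMap.comp_apply, ContinuousMap.coe_mk, h2, h2'] at this
        simpa using this
      · simp only [Prod.snd_add, Prod.smul_snd, smul_eq_mul]; positivity
      · simp only [ProbabilityMeasure.coe_mk, m, lintegral_add_measure, lintegral_smul_measure,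
          Prod.snd_add, Prod.smul_snd, smul_eq_mul]
        rw [ENNReal.ofReal_add (by positivity) (by positivity), ENNReal.ofReal_mul ha,
          ENNReal.ofReal_mul hb]
        gcongr
    let F : Y → (s → ℝ) × ℝ := fun y => (fun f => ∫ x, f.1 x ∂(κ y), (otCost c (κ y) ν).toReal)
    have hF1 : ∀ f : C(K, ℝ), Integrable (fun y => ∫ x, f x ∂(κ y)) Q := by
      intro f
      refine Integrable.of_bound (f.continuous.stronglyMeasurable.integral_kernel
        (κ := κ)).aestronglyMeasurable ‖f‖ (.of_forall fun y => ?_)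
      refine (norm_integral_le_of_norm_le_const (C := ‖f‖) (.of_forall fun x => ?_)).trans ?_
      · exact f.norm_coe_le_norm x
      · simp
    have hF1' : Integrable (fun y => (fun f : s => ∫ x, f.1 x ∂(κ y))) Q :=
      Integrable.of_eval fun f => hF1 f.1
    have hF2 : Integrable (fun y => (otCost c (κ y) ν).toReal) Q :=
      integrable_toReal_of_lintegral_ne_top hW.aemeasurable htop
    have hmem := hEconv.integral_mem (μ := Q) (f := F) hEc (by
      filter_upwards [hfin] with y hy
      obtain ⟨π, h1, h2, h3⟩ := aux_attain c hc (κ y) ν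
      refine ⟨π, (aux_map_eq_iff continuous_snd).1 h2, fun f =>
        (aux_map_eq_iff continuous_fst).1 h1 f.1, ENNReal.toReal_nonneg, ?_⟩
      rw [h3, ENNReal.ofReal_toReal hy.ne]) (hF1'.prodMk hF2)
    rw [integral_pair hF1' hF2] at hmem
    obtain ⟨π, h1, h2, h3, h4⟩ := hmem
    refine ⟨π, ⟨h1, ?_⟩, ?_⟩
    · refine h4.trans ?_
      simp only
      rw [integral_toReal hW.aemeasurable hfin, ENNReal.ofReal_toReal htop]
    · simp only [mem_iInter]
      intro f hf
      have := h2 ⟨f, hf⟩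
      simp only at this
      rw [eval_integral (fun i : s => hF1 i.1)] at this
      exact this
  obtain ⟨π, ⟨h1, h2⟩, h3⟩ := key
  have : IsProbabilityMeasure (Q.bind κ) := inferInstance
  rw [aux_le_iff c hc]
  refine ⟨π, (aux_map_eq_iff continuous_fst).2 fun f => ?_, (aux_map_eq_iff continuous_snd).2 h1, h2⟩
  have h3f : ∫ p, f p.1 ∂(π : Measure (K × K)) = ∫ y, ∫ x, f x ∂(κ y) ∂Q := mem_iInter.1 h3 f
  rw [h3f]
  have hb : (κ ∘ₖ Kernel.const Unit Q) () = Q.bind κ := by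
    rw [Kernel.comp_apply, Kernel.const_apply]
  have := Kernel.integral_comp (η := κ) (κ := Kernel.const Unit Q) (a := ()) (f := f)
    (by rw [hb]; exact aux_integrable f (Q.bind κ))
  rw [hb, Kernel.const_apply] at this
  exact this.symm

end Compact

section Polish

variable {X : Type*} [MeasurableSpace X] [TopologicalSpace X] [PolishSpace X] [BorelSpace X]

/-- Reduction of a Polish space to the Hilbert cube. -/
lemma aux_transport (c : X → X → ℝ≥0∞) (hc : LowerSemicontinuous fun p : X × X => c p.1 p.2) :
    ∃ (e : X → (ℕ → unitInterval)) (c' : (ℕ → unitInterval) → (ℕ → unitInterval) → ℝ≥0∞),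
      Measurable e ∧ (LowerSemicontinuous fun p : (ℕ → unitInterval) × (ℕ → unitInterval) =>
        c' p.1 p.2) ∧
      ∀ μ ν : Measure X, otCost c μ ν = otCost c' (μ.map e) (ν.map e) := by
  let _ := TopologicalSpace.upgradeIsCompletelyMetrizable X
  obtain ⟨e, he⟩ := Metric.PiNatEmbed.exists_embedding_to_hilbert_cube (X := X)
  have hme : MeasurableEmbedding e := he.continuous.measurableEmbedding he.injective
  let E : X × X → (ℕ → unitInterval) × (ℕ → unitInterval) := Prod.map e e
  have hE : IsEmbedding E := he.prodMap he
  have hmE : MeasurableEmbedding E := hme.prodMap hme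
  let C : (ℕ → unitInterval) × (ℕ → unitInterval) → ℝ≥0∞ := fun p =>
    ⨆ V : {V : Set ((ℕ → unitInterval) × (ℕ → unitInterval)) // IsOpen V ∧ p ∈ V},
      ⨅ q : {q : X × X // E q ∈ V.1}, c q.1.1 q.1.2
  have hC : LowerSemicontinuous C := by
    intro p a ha
    obtain ⟨⟨V, hV, hpV⟩, h⟩ := lt_iSup_iff.1 ha
    filter_upwards [hV.mem_nhds hpV] with p' hp'
    exact h.trans_le (le_iSup (fun V : {V : Set ((ℕ → unitInterval) × (ℕ → unitInterval)) //
      IsOpen V ∧ p' ∈ V} => ⨅ q : {q : X × X // E q ∈ V.1}, c q.1.1 q.1.2) ⟨V, hV, hp'⟩)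
  have hCE : ∀ q, C (E q) = c q.1 q.2 := by
    intro q
    apply le_antisymm
    · exact iSup_le fun V => iInf_le (fun q : {q : X × X // E q ∈ V.1} => c q.1.1 q.1.2)
        ⟨q, V.2.2⟩
    · refine le_of_forall_lt fun a ha => ?_
      obtain ⟨b, hab, hb⟩ := exists_between ha
      have hop : IsOpen ((fun p : X × X => c p.1 p.2) ⁻¹' Ioi b) := hc.isOpen_preimage b
      obtain ⟨V, hV, hVeq⟩ := hE.isInducing.isOpen_iff.1 hop
      have hq : E q ∈ V := by
        change q ∈ E ⁻¹' V
        rw [hVeq]; exact hb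
      refine hab.trans_le (le_trans ?_ (le_iSup (fun V : {V : Set ((ℕ → unitInterval) ×
        (ℕ → unitInterval)) // IsOpen V ∧ E q ∈ V} =>
          ⨅ q : {q : X × X // E q ∈ V.1}, c q.1.1 q.1.2) ⟨V, hV, hq⟩))
      refine le_iInf fun q' => ?_
      have : q'.1 ∈ E ⁻¹' V := q'.2
      rw [hVeq] at this
      exact (show b < _ from this).le
  refine ⟨e, fun x y => C (x, y), hme.measurable, hC, fun μ ν => le_antisymm ?_ ?_⟩
  · refine le_iInf₂ fun π hπ => ?_
    obtain ⟨h1, h2⟩ := hπ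
    have hr1 : ∀ᵐ p ∂π, p.1 ∈ range e := by
      have : ∀ᵐ x ∂(π.map Prod.fst), x ∈ range e := by
        rw [h1]; exact (ae_map_iff hme.measurable.aemeasurable hme.measurableSet_range).2 (by simp)
      exact ae_of_ae_map measurable_fst.aemeasurable this
    have hr2 : ∀ᵐ p ∂π, p.2 ∈ range e := by
      have : ∀ᵐ x ∂(π.map Prod.snd), x ∈ range e := by
        rw [h2]; exact (ae_map_iff hme.measurable.aemeasurable hme.measurableSet_range).2 (by simp)
      exact ae_of_ae_map measurable_snd.aemeasurable this
    have hr : ∀ᵐ p ∂π, p ∈ range E := by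
      filter_upwards [hr1, hr2] with p hp1 hp2
      rw [show range E = range e ×ˢ range e from range_prodMap]
      exact ⟨hp1, hp2⟩
    have hπ' : (π.comap E).map E = π := by
      rw [hmE.map_comap, Measure.restrict_eq_self_of_ae_mem hr]
    have hinj : ∀ m m' : Measure X, m.map e = m'.map e → m = m' := fun m m' h => by
      rw [← hme.comap_map m, h, hme.comap_map]
    refine le_trans (iInf₂_le (π.comap E) ⟨hinj _ _ ?h1, hinj _ _ ?h2⟩) ?h3
    rotate_left
    · rw [Measure.map_map hme.measurable measurable_fst,
        show e ∘ Prod.fst = Prod.fst ∘ E from rfl, ← Measure.map_map measurable_fst hmE.measurable,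
        hπ', h1]
    · rw [Measure.map_map hme.measurable measurable_snd,
        show e ∘ Prod.snd = Prod.snd ∘ E from rfl, ← Measure.map_map measurable_snd hmE.measurable,
        hπ', h2]
    · conv_rhs => rw [← hπ']
      rw [hmE.lintegral_map]
      exact (lintegral_congr fun q => (hCE q).symm).le
  · refine le_iInf₂ fun π hπ => ?_
    obtain ⟨h1, h2⟩ := hπ
    refine le_trans (iInf₂_le (π.map E) ⟨?g1, ?g2⟩) ?g3
    rotate_left
    · rw [Measure.map_map measurable_fst hmE.measurable,
        show Prod.fst ∘ E = e ∘ Prod.fst from rfl, ← Measure.map_map hme.measurable measurable_fst,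
        h1]
    · rw [Measure.map_map measurable_snd hmE.measurable,
        show Prod.snd ∘ E = e ∘ Prod.snd from rfl, ← Measure.map_map hme.measurable measurable_snd,
        h2]
    · rw [hmE.lintegral_map]
      exact (lintegral_congr fun q => hCE q).le

lemma aux_meas_polish (c : X → X → ℝ≥0∞) (hc : LowerSemicontinuous fun p : X × X => c p.1 p.2)
    {Y : Type*} [MeasurableSpace Y] (κ η : Kernel Y X) [IsMarkovKernel κ] [IsMarkovKernel η] :
    Measurable fun y => otCost c (κ y) (η y) := by
  obtain ⟨e, c', he, hc', h⟩ := aux_transport c hc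
  have : IsMarkovKernel (κ.map e) := Kernel.IsMarkovKernel.map κ he
  have : IsMarkovKernel (η.map e) := Kernel.IsMarkovKernel.map η he
  have := aux_meas c' hc' (κ.map e) (η.map e)
  simpa only [h, Kernel.map_apply _ he] using this

lemma aux_jensen_polish (c : X → X → ℝ≥0∞) (hc : LowerSemicontinuous fun p : X × X => c p.1 p.2)
    {Y : Type*} [MeasurableSpace Y] (Q : Measure Y) [IsProbabilityMeasure Q]
    (κ : Kernel Y X) [IsMarkovKernel κ] (ν : Measure X) [IsProbabilityMeasure ν] :
    otCost c (Q.bind κ) ν ≤ ∫⁻ y, otCost c (κ y) ν ∂Q := by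
  obtain ⟨e, c', he, hc', h⟩ := aux_transport c hc
  have : IsMarkovKernel (κ.map e) := Kernel.IsMarkovKernel.map κ he
  have : IsProbabilityMeasure (ν.map e) := Measure.isProbabilityMeasure_map he.aemeasurable
  have := aux_jensen c' hc' Q (κ.map e) (ν.map e)
  simp only [h]
  rw [Measure.map_comp Q κ he]
  simpa only [Kernel.map_apply _ he] using this

end Polish

/-- lower bound of Proposition 1: the latent conditional OT cost
`R_Z(Ḡ_X; Φ_Y) = ∫ W_{c_X}(P_{X|Z=z}, Ḡ_X(z,·) # P_U) P_Z(dz)` is bounded above by the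
conditional OT cost `R_Y(Ḡ_X; Φ_Y) = ∫ W_{c_X}(P_{X|Y=y}, Ḡ_X(Φ_Y(y),·) # P_U) P_Y(dy)`. -/
theorem latent_conditional_otCost_le_conditional_otCost
    {Y X Z U : Type*}
    [MeasurableSpace Y] [StandardBorelSpace Y]
    [MeasurableSpace X] [TopologicalSpace X] [PolishSpace X] [BorelSpace X]
    [MeasurableSpace Z] [StandardBorelSpace Z]
    [MeasurableSpace U] [StandardBorelSpace U]
    (cX : X → X → ℝ≥0∞) (hcX : LowerSemicontinuous fun p : X × X => cX p.1 p.2)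
    (PYX : Measure (Y × X)) [IsProbabilityMeasure PYX]
    (PY : Measure Y) [IsProbabilityMeasure PY] (hPY : PYX.map Prod.fst = PY)
    (κY : Kernel Y X) [IsMarkovKernel κY] (hdisY : PYX = PY.compProd κY)
    (ΦY : Y → Z) (hΦY : Measurable ΦY)
    (PZ : Measure Z) [IsProbabilityMeasure PZ] (hPZ : PY.map ΦY = PZ)
    (PZX : Measure (Z × X)) [IsProbabilityMeasure PZX]
    (hPZX : PYX.map (fun p : Y × X => (ΦY p.1, p.2)) = PZX)
    (κZ : Kernel Z X) [IsMarkovKernel κZ] (hdisZ : PZX = PZ.compProd κZ)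
    (PU : Measure U) [IsProbabilityMeasure PU]
    (GbarX : Z × U → X) (hGbarX : Measurable GbarX) :
    ∫⁻ z, otCost cX (κZ z) (PU.map (fun u => GbarX (z, u))) ∂PZ
      ≤ ∫⁻ y, otCost cX (κY y) (PU.map (fun u => GbarX (ΦY y, u))) ∂PY := by
  have hne : Nonempty Y := nonempty_of_isProbabilityMeasure PY
  let η : Kernel Z X := (Kernel.id ×ₖ Kernel.const Z PU).map GbarX
  have hηM : IsMarkovKernel η := Kernel.IsMarkovKernel.map _ hGbarX
  have hη : ∀ z, η z = PU.map (fun u => GbarX (z, u)) := by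
    intro z
    simp only [η]
    rw [Kernel.map_apply _ hGbarX, Kernel.prod_apply, Kernel.id_apply, Kernel.const_apply,
      Measure.dirac_prod, Measure.map_map hGbarX measurable_prodMk_left]
    rfl
  simp only [← hη]
  have hWm : Measurable fun y => otCost cX (κY y) (η (ΦY y)) :=
    aux_meas_polish cX hcX κY (η.comap ΦY hΦY)
  let Q : Kernel Z Y := condDistrib id ΦY PY
  have hQ : PZ ⊗ₘ Q = PY.map (fun y => (ΦY y, y)) := by
    rw [← hPZ]
    exact compProd_map_condDistrib (μ := PY) (X := ΦY) (Y := id) aemeasurable_id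
  have hΦQ : ∀ᵐ z ∂PZ, ∀ᵐ y ∂(Q z), ΦY y = z := by
    have : ∀ᵐ p ∂(PZ ⊗ₘ Q), ΦY p.2 = p.1 := by
      rw [hQ, ae_map_iff (by fun_prop) (measurableSet_eq_fun (by fun_prop) (by fun_prop))]
      simp
    exact Measure.ae_ae_of_ae_compProd this
  have hdis : PZ ⊗ₘ κZ = PZ ⊗ₘ (κY ∘ₖ Q) := by
    rw [← hdisZ, ← hPZX, hdisY]
    ext s hs
    have hm : Measurable fun p : Z × Y => κY p.2 (Prod.mk p.1 ⁻¹' s) :=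
      Kernel.measurable_kernel_prodMk_left (κ := Kernel.prodMkLeft Z κY)
        (t := (fun p : (Z × Y) × X => (p.1.1, p.2)) ⁻¹' s) (hs.preimage (by fun_prop))
    rw [Measure.map_apply (by fun_prop) hs, Measure.compProd_apply (hs.preimage (by fun_prop)),
      Measure.compProd_apply hs]
    simp_rw [fun z => Kernel.comp_apply' κY Q z (hs.preimage (measurable_prodMk_left (x := z)))]
    rw [← Measure.lintegral_compProd (f := fun p : Z × Y => κY p.2 (Prod.mk p.1 ⁻¹' s)) hm, hQ,
      lintegral_map hm (by fun_prop)]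
    rfl
  have hκ : κZ =ᵐ[PZ] (κY ∘ₖ Q) := Kernel.ae_eq_of_compProd_eq hdis
  calc ∫⁻ z, otCost cX (κZ z) (η z) ∂PZ
      ≤ ∫⁻ z, ∫⁻ y, otCost cX (κY y) (η (ΦY y)) ∂(Q z) ∂PZ := by
        refine lintegral_mono_ae ?_
        filter_upwards [hκ, hΦQ] with z hz hzQ
        rw [hz, Kernel.comp_apply]
        refine (aux_jensen_polish cX hcX (Q z) κY (η z)).trans_eq ?_
        refine lintegral_congr_ae ?_
        filter_upwards [hzQ] with y hy
        rw [hy]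
    _ = ∫⁻ p, otCost cX (κY p.2) (η (ΦY p.2)) ∂(PZ ⊗ₘ Q) :=
        (Measure.lintegral_compProd (hWm.comp measurable_snd)).symm
    _ = ∫⁻ y, otCost cX (κY y) (η (ΦY y)) ∂PY := by
        rw [hQ]
        exact lintegral_map (hWm.comp measurable_snd) (by fun_prop)
end

section
/- Reformulation of the latent conditional OT cost as a joint OT cost with a restricted cost (Theorem 1 of the paper, first step): Let G̃ : Z × U → Z × X be defined by G̃(z,u) = (z, Ḡ_X(z,u)), and define the cost c̃((z,x),(z',x')) = c_X(x,x') if z = z' and +∞ otherwise. Then ∫_Z W_{c_X}(P_{X|Z=z}, Ḡ_X(z,·) # P_U) P_Z(dz) = W_{c̃}(P_{Z,X}, G̃ # (P_Z ⊗ P_U)). -/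
open MeasureTheory ProbabilityTheory
open scoped ENNReal Classical

open Filter Topology Set in
lemma aux_lsc_real {Ω : Type*} [MeasurableSpace Ω] [TopologicalSpace Ω] [OpensMeasurableSpace Ω]
    {μ : Measure Ω} {μs : ℕ → Measure Ω} {f : Ω → ℝ} (f_lsc : LowerSemicontinuous f) (f_nn : 0 ≤ f)
    (h_opens : ∀ G, IsOpen G → μ G ≤ atTop.liminf (fun i ↦ μs i G)) :
    ∫⁻ x, ENNReal.ofReal (f x) ∂μ ≤ atTop.liminf (fun i ↦ ∫⁻ x, ENNReal.ofReal (f x) ∂(μs i)) := by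
  simp_rw [lintegral_eq_lintegral_meas_lt _ (Eventually.of_forall f_nn) f_lsc.measurable.aemeasurable]
  calc ∫⁻ (t : ℝ) in Set.Ioi 0, μ {a | t < f a}
      ≤ ∫⁻ (t : ℝ) in Set.Ioi 0, atTop.liminf (fun i ↦ (μs i) {a | t < f a}) :=
        lintegral_mono (fun t ↦ h_opens _ (f_lsc.isOpen_preimage t))
    _ ≤ atTop.liminf (fun i ↦ ∫⁻ (t : ℝ) in Set.Ioi 0, (μs i) {a | t < f a}) :=
        lintegral_liminf_le (fun n ↦ Antitone.measurable (fun s t hst ↦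
            measure_mono (fun ω hω ↦ lt_of_le_of_lt hst hω)))

open Filter Topology Set in
lemma aux_lsc {Ω : Type*} [MeasurableSpace Ω] [TopologicalSpace Ω] [OpensMeasurableSpace Ω]
    {μ : Measure Ω} {μs : ℕ → Measure Ω} {f : Ω → ℝ≥0∞} (f_lsc : LowerSemicontinuous f)
    (h_opens : ∀ G, IsOpen G → μ G ≤ atTop.liminf (fun i ↦ μs i G)) :
    ∫⁻ x, f x ∂μ ≤ atTop.liminf (fun i ↦ ∫⁻ x, f x ∂(μs i)) := by
  have hsup : ∀ x, f x = ⨆ n : ℕ, min (f x) n := by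
    intro x
    apply le_antisymm
    · refine le_of_forall_lt fun a ha => ?_
      obtain ⟨n, hn⟩ := ENNReal.exists_nat_gt (ne_top_of_lt ha)
      exact lt_of_lt_of_le (lt_min ha hn) (le_iSup (fun n : ℕ => min (f x) (n : ℝ≥0∞)) n)
    · exact iSup_le fun n => min_le_left _ _
  have hm : ∀ n : ℕ, Measurable fun x => min (f x) (n : ℝ≥0∞) := fun n =>
    f_lsc.measurable.min measurable_const
  have : ∫⁻ x, f x ∂μ = ⨆ n : ℕ, ∫⁻ x, min (f x) n ∂μ := by
    rw [← lintegral_iSup hm]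
    · exact lintegral_congr hsup
    · intro a b hab x
      exact min_le_min le_rfl (by exact_mod_cast hab)
  rw [this]
  refine iSup_le fun n => ?_
  have hfin : ∀ x, min (f x) (n : ℝ≥0∞) ≠ ⊤ := fun x =>
    ne_top_of_le_ne_top (ENNReal.natCast_ne_top n) (min_le_right _ _)
  have hl : LowerSemicontinuous fun x => (min (f x) (n : ℝ≥0∞)).toReal := by
    intro x y hy
    rcases lt_or_ge y 0 with h0 | h0
    · exact Eventually.of_forall fun _ => h0.trans_le ENNReal.toReal_nonneg
    · have h1 : ENNReal.ofReal y < min (f x) n := by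
        rw [ENNReal.ofReal_lt_iff_lt_toReal h0 (hfin x)]; exact hy
      filter_upwards [f_lsc x _ (h1.trans_le (min_le_left _ _))] with x' hx'
      rw [gt_iff_lt, ← ENNReal.ofReal_lt_iff_lt_toReal h0 (hfin _)]
      exact lt_min hx' (h1.trans_le (min_le_right _ _))
  have key := aux_lsc_real hl (fun x => ENNReal.toReal_nonneg) h_opens
  simp_rw [ENNReal.ofReal_toReal (hfin _)] at key
  refine key.trans (liminf_le_liminf (Eventually.of_forall fun i => ?_))
  exact lintegral_mono fun x => min_le_left _ _

open Filter Topology Set in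
lemma aux_opens (X : Type*) [MeasurableSpace X] [TopologicalSpace X] [SecondCountableTopology X] :
    ∃ A : ℕ → Set X, (∀ j, IsOpen (A j)) ∧
      ∀ G, IsOpen G → ∀ μ : Measure X, ∀ r < μ G, ∃ j, A j ⊆ G ∧ r < μ (A j) := by
  obtain ⟨b, hb⟩ := TopologicalSpace.exists_seq_basis X
  have hbo : ∀ k, IsOpen (b k) := fun k => hb.isOpen (mem_range_self k)
  obtain ⟨e, he⟩ := exists_surjective_nat (Finset ℕ)
  refine ⟨fun j => ⋃ k ∈ e j, b k, fun j => isOpen_biUnion fun k _ => hbo k, ?_⟩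
  intro G hG μ r hr
  have hGu : G = ⋃ k : ℕ, (if b k ⊆ G then b k else ∅) := by
    apply Subset.antisymm
    · intro x hx
      obtain ⟨s, ⟨k, rfl⟩, hxs, hsG⟩ := hb.exists_subset_of_mem_open hx hG
      exact mem_iUnion.2 ⟨k, by rw [if_pos hsG]; exact hxs⟩
    · refine iUnion_subset fun k => ?_
      split_ifs with h
      · exact h
      · exact empty_subset _
  have ht := tendsto_measure_iUnion_accumulate (μ := μ) (f := fun k : ℕ => (if b k ⊆ G then b k else ∅))
  rw [← hGu] at ht
  obtain ⟨n, hn⟩ := ((tendsto_order.1 ht).1 r hr).exists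
  obtain ⟨j, hj⟩ := he ((Finset.range (n+1)).filter fun k => b k ⊆ G)
  refine ⟨j, ?_, hn.trans_le (measure_mono ?_)⟩
  · simp only [hj]
    refine iUnion₂_subset fun k hk => (Finset.mem_filter.1 hk).2
  · intro x hx
    simp only [accumulate_def, mem_iUnion] at hx
    obtain ⟨k, hk, hx⟩ := hx
    split_ifs at hx with h
    · simp only [hj, mem_iUnion]
      exact ⟨k, Finset.mem_filter.2 ⟨Finset.mem_range.2 (by simpa [Nat.lt_succ_iff] using hk), h⟩, hx⟩
    · exact hx.elim

open Filter Topology Set in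
lemma aux_dense {Y E : Type*} [Nonempty Y] [TopologicalSpace E] [SecondCountableTopology E]
    (T : Y → E) : ∃ g : ℕ → Y, ∀ y, ∀ O : Set E, IsOpen O → T y ∈ O → ∃ i, T (g i) ∈ O := by
  have : Nonempty (range T) := ⟨⟨_, mem_range_self (Classical.arbitrary Y)⟩⟩
  obtain ⟨u, hu⟩ := TopologicalSpace.exists_dense_seq (range T)
  choose g hg using fun i => (u i).2
  refine ⟨g, fun y O hO hy => ?_⟩
  obtain ⟨i, hi⟩ := hu.exists_mem_open (hO.preimage continuous_subtype_val)
    ⟨⟨T y, mem_range_self y⟩, hy⟩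
  exact ⟨i, by rw [hg]; exact hi⟩

open Filter Topology Set in
lemma aux_select {Z X : Type*} [MeasurableSpace Z] [MeasurableSpace X]
    (c : X → X → ℝ≥0∞) (P : Measure Z) [IsProbabilityMeasure P]
    (κ η : Kernel Z X) [IsMarkovKernel κ] [IsMarkovKernel η]
    (A : ℕ → Set X) (hA : ∀ j, MeasurableSet (A j)) (n : ℕ) (ε : ℝ≥0∞) (hε : 0 < ε) :
    ∃ θ : Kernel Z (X × X), IsMarkovKernel θ ∧
      (∀ z, ∀ j < n, κ z (A j) ≤ θ z (Prod.fst ⁻¹' A j) + ε) ∧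
      (∀ z, ∀ j < n, η z (A j) ≤ θ z (Prod.snd ⁻¹' A j) + ε) ∧
      ∫⁻ z, ∫⁻ p, c p.1 p.2 ∂(θ z) ∂P ≤ ∫⁻ z, otCost c (κ z) (η z) ∂P + ε := by
  let Y := ProbabilityMeasure (X × X)
  obtain ⟨z₀⟩ : Nonempty Z := nonempty_of_isProbabilityMeasure P
  have : Nonempty Y := ⟨⟨(κ z₀).prod (η z₀), inferInstance⟩⟩
  let T : Y → (ℕ → ℝ≥0∞) × (ℕ → ℝ≥0∞) × ℝ≥0∞ := fun γ =>
    (fun j => (γ : Measure (X × X)) (Prod.fst ⁻¹' A j),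
     fun j => (γ : Measure (X × X)) (Prod.snd ⁻¹' A j), ∫⁻ p, c p.1 p.2 ∂(γ : Measure (X × X)))
  obtain ⟨g, hg⟩ := aux_dense T
  let C : ℕ → ℝ≥0∞ := fun i => (T (g i)).2.2
  let cond : ℕ → Z → Prop := fun i z =>
    (∀ j < n, κ z (A j) < (T (g i)).1 j + ε) ∧ (∀ j < n, η z (A j) < (T (g i)).2.1 j + ε)
  have hcm : ∀ i, MeasurableSet {z | cond i z} := by
    intro i
    have : {z | cond i z} = (⋂ j, ⋂ (_ : j < n), {z | κ z (A j) < (T (g i)).1 j + ε}) ∩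
        (⋂ j, ⋂ (_ : j < n), {z | η z (A j) < (T (g i)).2.1 j + ε}) := by
      ext z; simp [cond]
    rw [this]
    refine MeasurableSet.inter ?_ ?_
    · exact MeasurableSet.iInter fun j => MeasurableSet.iInter fun _ =>
        measurableSet_lt (κ.measurable_coe (hA j)) measurable_const
    · exact MeasurableSet.iInter fun j => MeasurableSet.iInter fun _ =>
        measurableSet_lt (η.measurable_coe (hA j)) measurable_const
  let V : Z → ℝ≥0∞ := fun z => ⨅ i, if cond i z then C i else ⊤
  have hVm : Measurable V := by
    refine Measurable.iInf fun i => ?_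
    exact Measurable.ite (hcm i) measurable_const measurable_const
  -- any coupling is approximated
  have happ : ∀ z, ∀ γ : Measure (X × X), γ.map Prod.fst = κ z → γ.map Prod.snd = η z →
      ∀ r, ∫⁻ p, c p.1 p.2 ∂γ < r → ∃ i, cond i z ∧ C i < r := by
    intro z γ h1 h2 r hr
    have : IsProbabilityMeasure γ := by
      constructor
      have := congrArg (fun m => m univ) h1
      simpa [Measure.map_apply measurable_fst MeasurableSet.univ] using this
    let O : Set ((ℕ → ℝ≥0∞) × (ℕ → ℝ≥0∞) × ℝ≥0∞) :=
      {t | (∀ j < n, κ z (A j) < t.1 j + ε) ∧ (∀ j < n, η z (A j) < t.2.1 j + ε) ∧ t.2.2 < r}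
    have hO : IsOpen O := by
      have : O = (⋂ j ∈ Finset.range n, {t | κ z (A j) < t.1 j + ε}) ∩
          ((⋂ j ∈ Finset.range n, {t | η z (A j) < t.2.1 j + ε}) ∩ {t | t.2.2 < r}) := by
        ext t; simp [O]
      rw [this]
      refine IsOpen.inter ?_ (IsOpen.inter ?_ ?_)
      · refine isOpen_biInter_finset fun j _ => ?_
        exact isOpen_lt continuous_const (by fun_prop)
      · refine isOpen_biInter_finset fun j _ => ?_
        exact isOpen_lt continuous_const (by fun_prop)
      · exact isOpen_lt (by fun_prop) continuous_const
    have hmem : T ⟨γ, this⟩ ∈ O := by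
      refine ⟨fun j _ => ?_, fun j _ => ?_, hr⟩
      · have : γ (Prod.fst ⁻¹' A j) = κ z (A j) := by
          rw [← h1, Measure.map_apply measurable_fst (hA j)]
        simp only [T, ProbabilityMeasure.coe_mk, this]
        exact ENNReal.lt_add_right (measure_ne_top _ _) hε.ne'
      · have : γ (Prod.snd ⁻¹' A j) = η z (A j) := by
          rw [← h2, Measure.map_apply measurable_snd (hA j)]
        simp only [T, ProbabilityMeasure.coe_mk, this]
        exact ENNReal.lt_add_right (measure_ne_top _ _) hε.ne'
    obtain ⟨i, hi⟩ := hg _ O hO hmem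
    exact ⟨i, ⟨hi.1, hi.2.1⟩, hi.2.2⟩
  have hVW : ∀ z, V z ≤ otCost c (κ z) (η z) := by
    intro z
    refine le_iInf₂ fun γ hγ => ?_
    refine le_of_forall_gt fun r hr => ?_
    obtain ⟨i, hi, hir⟩ := happ z γ hγ.1 hγ.2 r hr
    refine lt_of_le_of_lt (iInf_le _ i) ?_
    simpa only [if_pos hi] using hir
  have hex : ∀ z, ∃ i, cond i z ∧ C i ≤ V z + ε := by
    intro z
    rcases eq_or_ne (V z) ⊤ with htop | hne
    · -- the condition is satisfiable through the product coupling
      have : ∃ i, cond i z := by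
        by_contra hcon
        push Not at hcon
        let γ : Y := ⟨(κ z).prod (η z), inferInstance⟩
        obtain ⟨i, hi⟩ := hg γ
          ((⋂ j ∈ Finset.range n, {t | κ z (A j) < t.1 j + ε}) ∩
          (⋂ j ∈ Finset.range n, {t | η z (A j) < t.2.1 j + ε}))
          (by
            refine IsOpen.inter ?_ ?_
            · refine isOpen_biInter_finset fun j _ => ?_
              exact isOpen_lt continuous_const (by fun_prop)
            · refine isOpen_biInter_finset fun j _ => ?_
              exact isOpen_lt continuous_const (by fun_prop))
          (by
            have h1 : ∀ j, (T γ).1 j = κ z (A j) := fun j => by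
              change ((κ z).prod (η z)) (Prod.fst ⁻¹' A j) = _
              rw [← Set.prod_univ, Measure.prod_prod, measure_univ, mul_one]
            have h2 : ∀ j, (T γ).2.1 j = η z (A j) := fun j => by
              change ((κ z).prod (η z)) (Prod.snd ⁻¹' A j) = _
              rw [← Set.univ_prod, Measure.prod_prod, measure_univ, one_mul]
            simp only [mem_inter_iff, mem_iInter, mem_ofPred_eq, h1, h2]
            exact ⟨fun j _ => ENNReal.lt_add_right (measure_ne_top _ _) hε.ne',
              fun j _ => ENNReal.lt_add_right (measure_ne_top _ _) hε.ne'⟩)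
        simp only [mem_inter_iff, mem_iInter, mem_ofPred_eq, Finset.mem_range] at hi
        exact hcon i hi
      obtain ⟨i, hi⟩ := this
      exact ⟨i, hi, by simp [htop]⟩
    · have hlt : V z < V z + ε := ENNReal.lt_add_right hne hε.ne'
      obtain ⟨i, hi⟩ := iInf_lt_iff.1 hlt
      by_cases h : cond i z
      · rw [if_pos h] at hi
        exact ⟨i, h, hi.le⟩
      · rw [if_neg h] at hi
        exact absurd hi not_top_lt
  let I : Z → ℕ := fun z => Nat.find (hex z)
  have hI : Measurable I := by
    refine measurable_find hex fun k => ?_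
    exact (hcm k).inter (measurableSet_le measurable_const (hVm.add_const _))
  have hIs : ∀ z, cond (I z) z ∧ C (I z) ≤ V z + ε := fun z => Nat.find_spec (hex z)
  let θ : Kernel Z (X × X) :=
    ⟨fun z => (g (I z) : Measure (X × X)),
      (measurable_from_nat (f := fun i => (g i : Measure (X × X)))).comp hI⟩
  refine ⟨θ, ⟨fun z => (g (I z)).2⟩, fun z j hj => ((hIs z).1.1 j hj).le,
    fun z j hj => ((hIs z).1.2 j hj).le, ?_⟩
  calc ∫⁻ z, ∫⁻ p, c p.1 p.2 ∂(θ z) ∂P ≤ ∫⁻ z, (V z + ε) ∂P :=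
        lintegral_mono fun z => (hIs z).2
    _ = ∫⁻ z, V z ∂P + ε := by
        rw [lintegral_add_right _ measurable_const]; simp
    _ ≤ _ := by gcongr with z; exact hVW z

open Filter Topology Set in
lemma aux_conv {Z X : Type*}
    [MeasurableSpace Z] [TopologicalSpace Z] [PolishSpace Z] [BorelSpace Z]
    [MeasurableSpace X] [TopologicalSpace X] [PolishSpace X] [BorelSpace X]
    (P : Measure Z) [IsProbabilityMeasure P]
    (κ : Kernel Z X) [IsMarkovKernel κ] (κs : ℕ → Kernel Z X) [∀ n, IsMarkovKernel (κs n)]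
    (A : ℕ → Set X)
    (hA : ∀ G, IsOpen G → ∀ μ : Measure X, ∀ r < μ G, ∃ j, A j ⊆ G ∧ r < μ (A j))
    (h : ∀ n z, ∀ j < n, κ z (A j) ≤ κs n z (A j) + ((n : ℝ≥0∞) + 1)⁻¹) :
    ∀ G : Set (Z × X), IsOpen G → (P ⊗ₘ κ) G ≤ atTop.liminf fun n => (P ⊗ₘ κs n) G := by
  intro G hG
  simp_rw [Measure.compProd_apply hG.measurableSet]
  refine le_trans (lintegral_mono fun z => ?_)
    (lintegral_liminf_le fun n => Kernel.measurable_kernel_prodMk_left hG.measurableSet)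
  have hGz : IsOpen (Prod.mk z ⁻¹' G) := hG.preimage (by fun_prop)
  refine le_of_forall_lt fun r hr => ?_
  obtain ⟨j, hj, hrj⟩ := hA _ hGz (κ z) r hr
  refine hrj.trans_le ?_
  have hε : Tendsto (fun n : ℕ => ((n : ℝ≥0∞) + 1)⁻¹) atTop (𝓝 0) := by
    have := (tendsto_add_atTop_iff_nat 1).2 ENNReal.tendsto_inv_nat_nhds_zero
    simpa using this
  have ht : Tendsto (fun n : ℕ => κ z (A j) - ((n : ℝ≥0∞) + 1)⁻¹) atTop (𝓝 (κ z (A j))) := by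
    have := ENNReal.Tendsto.sub (tendsto_const_nhds (x := κ z (A j)) (f := atTop)) hε
      (Or.inl (measure_ne_top _ _))
    simpa using this
  rw [← ht.liminf_eq]
  refine liminf_le_liminf ?_
  filter_upwards [eventually_gt_atTop j] with n hn
  rw [tsub_le_iff_right]
  refine (h n z j hn).trans ?_
  gcongr

open Filter Topology Set in
lemma aux_tight {Y : Type*}
    [MeasurableSpace Y] [TopologicalSpace Y] [PolishSpace Y] [BorelSpace Y]
    (μs : ℕ → ProbabilityMeasure Y) (μ : ProbabilityMeasure Y) (h : Tendsto μs atTop (𝓝 μ)) :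
    IsTightMeasureSet {((ν : ProbabilityMeasure Y) : Measure Y) | ν ∈ range μs} := by
  let _ := TopologicalSpace.upgradeIsCompletelyMetrizable Y
  apply isTightMeasureSet_of_isCompact_closure
  refine h.isCompact_insert_range.closure_of_subset (subset_insert _ _)

open Filter Topology Set in
/-- The limit step: from almost-couplings to a genuine coupling. -/
lemma aux_le {Z X : Type*}
    [MeasurableSpace Z] [TopologicalSpace Z] [PolishSpace Z] [BorelSpace Z]
    [MeasurableSpace X] [TopologicalSpace X] [PolishSpace X] [BorelSpace X]
    (c : X → X → ℝ≥0∞) (hc : LowerSemicontinuous fun p : X × X => c p.1 p.2)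
    (P : Measure Z) [IsProbabilityMeasure P]
    (κ η : Kernel Z X) [IsMarkovKernel κ] [IsMarkovKernel η] :
    otCost (fun p q : Z × X => if p.1 = q.1 then c p.2 q.2 else ⊤) (P ⊗ₘ κ) (P ⊗ₘ η)
      ≤ ∫⁻ z, otCost c (κ z) (η z) ∂P := by
  obtain ⟨A, hAo, hA⟩ := aux_opens X
  choose θ hθ h1 h2 hcost using fun n : ℕ => aux_select c P κ η A (fun j => (hAo j).measurableSet) n
    ((n : ℝ≥0∞) + 1)⁻¹ (by simp)
  let f1 : Z × (X × X) → Z × X := fun p => (p.1, p.2.1)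
  let f2 : Z × (X × X) → Z × X := fun p => (p.1, p.2.2)
  have hf1 : Continuous f1 := by fun_prop
  have hf2 : Continuous f2 := by fun_prop
  let π : ℕ → ProbabilityMeasure (Z × (X × X)) := fun n => ⟨P ⊗ₘ θ n, inferInstance⟩
  have hm1 : ∀ n, (P ⊗ₘ θ n).map f1 = P ⊗ₘ (θ n).map Prod.fst := fun n => by
    rw [Measure.compProd_map measurable_fst]; rfl
  have hm2 : ∀ n, (P ⊗ₘ θ n).map f2 = P ⊗ₘ (θ n).map Prod.snd := fun n => by
    rw [Measure.compProd_map measurable_snd]; rfl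
  have : ∀ n, IsMarkovKernel ((θ n).map Prod.fst) := fun n => Kernel.IsMarkovKernel.map _ measurable_fst
  have : ∀ n, IsMarkovKernel ((θ n).map Prod.snd) := fun n => Kernel.IsMarkovKernel.map _ measurable_snd
  let μ1 : ProbabilityMeasure (Z × X) := ⟨P ⊗ₘ κ, inferInstance⟩
  let μ2 : ProbabilityMeasure (Z × X) := ⟨P ⊗ₘ η, inferInstance⟩
  have ht1 : Tendsto (fun n => (π n).map hf1.measurable.aemeasurable) atTop (𝓝 μ1) := by
    refine tendsto_of_forall_isOpen_le_liminf' fun G hG => ?_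
    have := aux_conv P κ (fun n => (θ n).map Prod.fst) A hA (fun n z j hj => by
      rw [Kernel.map_apply' _ measurable_fst _ (hAo j).measurableSet]
      exact h1 n z j hj) G hG
    simp only [← hm1] at this
    exact this
  have ht2 : Tendsto (fun n => (π n).map hf2.measurable.aemeasurable) atTop (𝓝 μ2) := by
    refine tendsto_of_forall_isOpen_le_liminf' fun G hG => ?_
    have := aux_conv P η (fun n => (θ n).map Prod.snd) A hA (fun n z j hj => by
      rw [Kernel.map_apply' _ measurable_snd _ (hAo j).measurableSet]
      exact h2 n z j hj) G hG
    simp only [← hm2] at this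
    exact this
  have hT1 := aux_tight _ _ ht1
  have hT2 := aux_tight _ _ ht2
  have hT : IsTightMeasureSet {((ν : ProbabilityMeasure _) : Measure (Z × (X × X))) | ν ∈ range π} := by
    refine IsTightMeasureSet.prodMk ?_ (IsTightMeasureSet.prodMk ?_ ?_)
    · refine (hT1.map continuous_fst).subset ?_
      rintro _ ⟨_, ⟨_, ⟨n, rfl⟩, rfl⟩, rfl⟩
      refine ⟨_, ⟨_, ⟨n, rfl⟩, rfl⟩, ?_⟩
      rw [ProbabilityMeasure.toMeasure_map, Measure.map_map measurable_fst hf1.measurable]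
      rfl
    · refine (hT1.map continuous_snd).subset ?_
      rintro _ ⟨_, ⟨_, ⟨_, ⟨n, rfl⟩, rfl⟩, rfl⟩, rfl⟩
      refine ⟨_, ⟨_, ⟨n, rfl⟩, rfl⟩, ?_⟩
      rw [ProbabilityMeasure.toMeasure_map, Measure.map_map measurable_snd hf1.measurable,
        Measure.fst, Measure.snd, Measure.map_map measurable_fst measurable_snd]
      rfl
    · refine (hT2.map continuous_snd).subset ?_
      rintro _ ⟨_, ⟨_, ⟨_, ⟨n, rfl⟩, rfl⟩, rfl⟩, rfl⟩
      refine ⟨_, ⟨_, ⟨n, rfl⟩, rfl⟩, ?_⟩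
      rw [ProbabilityMeasure.toMeasure_map, Measure.map_map measurable_snd hf2.measurable,
        Measure.snd, Measure.snd, Measure.map_map measurable_snd measurable_snd]
      rfl
  have hcomp := isCompact_closure_of_isTightMeasureSet hT
  obtain ⟨ρ, -, φ, hφ, hlim⟩ := hcomp.tendsto_subseq (x := π) fun n => subset_closure ⟨n, rfl⟩
  have hρ1 : ρ.map hf1.measurable.aemeasurable = μ1 :=
    tendsto_nhds_unique (((ProbabilityMeasure.continuous_map hf1).tendsto ρ).comp hlim)
      (ht1.comp hφ.tendsto_atTop)
  have hρ2 : ρ.map hf2.measurable.aemeasurable = μ2 :=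
    tendsto_nhds_unique (((ProbabilityMeasure.continuous_map hf2).tendsto ρ).comp hlim)
      (ht2.comp hφ.tendsto_atTop)
  have hρ1' : (ρ : Measure _).map f1 = P ⊗ₘ κ := congrArg Subtype.val hρ1
  have hρ2' : (ρ : Measure _).map f2 = P ⊗ₘ η := congrArg Subtype.val hρ2
  have hlsc : LowerSemicontinuous fun p : Z × (X × X) => c p.2.1 p.2.2 :=
    hc.comp continuous_snd
  have hε : Tendsto (fun n : ℕ => ((n : ℝ≥0∞) + 1)⁻¹) atTop (𝓝 0) := by
    have := (tendsto_add_atTop_iff_nat 1).2 ENNReal.tendsto_inv_nat_nhds_zero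
    simpa using this
  have hfinal : ∫⁻ p, c p.2.1 p.2.2 ∂(ρ : Measure (Z × (X × X))) ≤ ∫⁻ z, otCost c (κ z) (η z) ∂P := by
    refine (aux_lsc hlsc fun G hG =>
      ProbabilityMeasure.le_liminf_measure_open_of_tendsto hlim hG).trans ?_
    have hlim2 : Tendsto (fun n => ∫⁻ z, otCost c (κ z) (η z) ∂P + ((φ n : ℝ≥0∞) + 1)⁻¹) atTop
        (𝓝 (∫⁻ z, otCost c (κ z) (η z) ∂P)) := by
      simpa using (tendsto_const_nhds (x := ∫⁻ z, otCost c (κ z) (η z) ∂P)).add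
        (hε.comp hφ.tendsto_atTop)
    rw [← hlim2.liminf_eq]
    refine liminf_le_liminf (Eventually.of_forall fun n => ?_)
    refine le_trans (le_of_eq ?_) (hcost (φ n))
    exact Measure.lintegral_compProd hlsc.measurable
  let F : Z × (X × X) → (Z × X) × (Z × X) := fun p => (f1 p, f2 p)
  have hF : Measurable F := hf1.measurable.prodMk hf2.measurable
  refine (iInf₂_le ((ρ : Measure _).map F) ⟨?_, ?_⟩).trans (le_trans ?_ hfinal)
  rotate_left
  · rw [Measure.map_map measurable_fst hF, ← hρ1']; rfl
  · rw [Measure.map_map measurable_snd hF, ← hρ2']; rfl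
  · dsimp only
    rw [lintegral_map _ hF]
    · simp [F, f1, f2]
    · refine Measurable.ite (measurableSet_eq_fun (by fun_prop) (by fun_prop)) ?_ measurable_const
      exact hc.measurable.comp (f := fun p : (Z × X) × (Z × X) => (p.1.2, p.2.2)) (by fun_prop)

lemma aux_ge {Z X : Type*}
    [MeasurableSpace Z] [TopologicalSpace Z] [PolishSpace Z] [BorelSpace Z]
    [MeasurableSpace X] [TopologicalSpace X] [PolishSpace X] [BorelSpace X]
    (c : X → X → ℝ≥0∞) (hc : LowerSemicontinuous fun p : X × X => c p.1 p.2)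
    (P : Measure Z) [IsProbabilityMeasure P]
    (κ η : Kernel Z X) [IsMarkovKernel κ] [IsMarkovKernel η] :
    ∫⁻ z, otCost c (κ z) (η z) ∂P ≤
    otCost (fun p q : Z × X => if p.1 = q.1 then c p.2 q.2 else ⊤) (P ⊗ₘ κ) (P ⊗ₘ η) := by
  refine le_iInf₂ fun π hπ => ?_
  obtain ⟨hπ1, hπ2⟩ := hπ
  have : IsProbabilityMeasure π := by
    constructor
    have := congrArg (fun m => m Set.univ) hπ1
    simpa [Measure.map_apply measurable_fst MeasurableSet.univ] using this
  obtain ⟨z₀⟩ : Nonempty Z := nonempty_of_isProbabilityMeasure P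
  have : Nonempty X := nonempty_of_isProbabilityMeasure (κ z₀)
  have hcm : Measurable fun p : (Z × X) × (Z × X) =>
      if p.1.1 = p.2.1 then c p.1.2 p.2.2 else ⊤ := by
    refine Measurable.ite (measurableSet_eq_fun (by fun_prop) (by fun_prop)) ?_ measurable_const
    exact hc.measurable.comp (f := fun p : (Z × X) × (Z × X) => (p.1.2, p.2.2)) (by fun_prop)
  rcases eq_or_ne (∫⁻ p, (if p.1.1 = p.2.1 then c p.1.2 p.2.2 else ⊤) ∂π) ⊤ with htop | hne
  · exact le_top.trans_eq htop.symm
  have hdiag : ∀ᵐ p ∂π, p.1.1 = p.2.1 := by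
    filter_upwards [ae_lt_top hcm hne] with p hp
    by_contra h
    simp [h] at hp
  let F : (Z × X) × (Z × X) → Z × (X × X) := fun p => (p.1.1, (p.1.2, p.2.2))
  have hF : Measurable F := by fun_prop
  let ρ := π.map F
  have : IsProbabilityMeasure ρ := Measure.isProbabilityMeasure_map hF.aemeasurable
  let γ := ρ.condKernel
  have hρfst : ρ.fst = P := by
    rw [← Measure.fst_compProd P κ, ← hπ1, Measure.fst, Measure.fst, Measure.map_map measurable_fst hF,
      Measure.map_map measurable_fst measurable_fst]
    rfl
  have hdis : P ⊗ₘ γ = ρ := by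
    rw [← hρfst]; exact ρ.disintegrate ρ.condKernel
  have : IsMarkovKernel (γ.map Prod.fst) := Kernel.IsMarkovKernel.map _ measurable_fst
  have : IsMarkovKernel (γ.map Prod.snd) := Kernel.IsMarkovKernel.map _ measurable_snd
  have e1 : γ.map Prod.fst =ᵐ[P] κ := by
    apply Kernel.ae_eq_of_compProd_eq
    rw [Measure.compProd_map measurable_fst, hdis, ← hπ1, Measure.map_map (by fun_prop) hF]
    rfl
  have e2 : γ.map Prod.snd =ᵐ[P] η := by
    apply Kernel.ae_eq_of_compProd_eq
    rw [Measure.compProd_map measurable_snd, hdis, ← hπ2, Measure.map_map (by fun_prop) hF]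
    apply Measure.map_congr
    filter_upwards [hdiag] with p hp
    exact Prod.ext hp rfl
  have hcm' : Measurable fun p : Z × (X × X) => c p.2.1 p.2.2 :=
    hc.measurable.comp measurable_snd
  calc ∫⁻ z, otCost c (κ z) (η z) ∂P ≤ ∫⁻ z, ∫⁻ p, c p.1 p.2 ∂(γ z) ∂P := by
        refine lintegral_mono_ae ?_
        filter_upwards [e1, e2] with z h1 h2
        refine iInf₂_le (γ z) ⟨?_, ?_⟩
        · rw [← h1, Kernel.map_apply _ measurable_fst]
        · rw [← h2, Kernel.map_apply _ measurable_snd]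
    _ = ∫⁻ p, c p.2.1 p.2.2 ∂ρ := by
        rw [← hdis, Measure.lintegral_compProd hcm']
    _ = ∫⁻ p, c p.1.2 p.2.2 ∂π := lintegral_map hcm' hF
    _ ≤ _ := by
        refine lintegral_mono fun p => ?_
        dsimp only
        split_ifs
        · exact le_rfl
        · exact le_top

/-- the latent conditional OT cost equals the joint OT cost on `Z × X` with the
diagonal-restricted cost `c̃((z,x),(z',x')) = c_X(x,x')` if `z = z'`, `+∞` otherwise, where the
second marginal is the pushforward of `P_Z ⊗ P_U` under `G̃(z,u) = (z, Ḡ_X(z,u))`. -/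
theorem latent_conditional_otCost_eq_joint_restricted
    {Z X U : Type*}
    [MeasurableSpace Z] [TopologicalSpace Z] [PolishSpace Z] [BorelSpace Z]
    [MeasurableSpace X] [TopologicalSpace X] [PolishSpace X] [BorelSpace X]
    [MeasurableSpace U] [TopologicalSpace U] [PolishSpace U] [BorelSpace U]
    (cX : X → X → ℝ≥0∞) (hcX : LowerSemicontinuous fun p : X × X => cX p.1 p.2)
    (PZX : Measure (Z × X)) [IsProbabilityMeasure PZX]
    (PZ : Measure Z) [IsProbabilityMeasure PZ] (hPZ : PZX.map Prod.fst = PZ)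
    (κ : Kernel Z X) [IsMarkovKernel κ] (hdis : PZX = PZ.compProd κ)
    (PU : Measure U) [IsProbabilityMeasure PU]
    (GbarX : Z × U → X) (hGbarX : Measurable GbarX) :
    ∫⁻ z, otCost cX (κ z) (PU.map (fun u => GbarX (z, u))) ∂PZ
      = otCost (fun p q : Z × X => if p.1 = q.1 then cX p.2 q.2 else ⊤) PZX
          ((PZ.prod PU).map (fun p : Z × U => (p.1, GbarX p))) := by
  let η : Kernel Z X := ⟨fun z => PU.map (fun u => GbarX (z, u)), by
    refine Measure.measurable_of_measurable_coe _ fun s hs => ?_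
    have : ∀ z, (PU.map (fun u => GbarX (z, u))) s = PU (Prod.mk z ⁻¹' (GbarX ⁻¹' s)) := fun z => by
      rw [Measure.map_apply (by fun_prop) hs]; rfl
    simp_rw [this]
    exact measurable_measure_prodMk_left (hGbarX hs)⟩
  have hη : ∀ z, η z = PU.map (fun u => GbarX (z, u)) := fun z => rfl
  have : IsMarkovKernel η :=
    ⟨fun z => Measure.isProbabilityMeasure_map (μ := PU) (f := fun u => GbarX (z, u)) (by fun_prop)⟩
  have hη2 : (PZ.prod PU).map (fun p : Z × U => (p.1, GbarX p)) = PZ ⊗ₘ η := by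
    ext s hs
    rw [Measure.map_apply (by fun_prop) hs, Measure.compProd_apply hs,
      Measure.prod_apply ((by fun_prop : Measurable fun p : Z × U => (p.1, GbarX p)) hs)]
    refine lintegral_congr fun z => ?_
    rw [hη, Measure.map_apply (by fun_prop) (measurable_prodMk_left hs)]
    rfl
  rw [hη2, hdis]
  exact le_antisymm (aux_ge cX hcX PZ κ η) (aux_le cX hcX PZ κ η)
end
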